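/- arXiv:1609.08948 — 4 statements merged into one kernel-verified Lean document; each statement's English description precedes it below -/
import Mathlib

section
/- Let k > 0 and ϑ > 0. Let x : [0,∞) → ℝ be twice continuously differentiable with x''(t) + k x'(t) + ϑ x(t) = 1 for all t ≥ 0 and x(0) = x'(0) = 0, and let y : [0,∞) → ℝ be twice continuously differentiable with y''(t) + k y'(t) + ϑ y(t) = −x(t) for all t ≥ 0 and y(0) = y'(0) = 0 (so that y is the sensitivity ∂x/∂ϑ). Then (1/T)·∫₀ᵀ y(t)² dt → 1/ϑ⁴ as T → ∞. (This is the normalized Fisher information of the white-noise observation model dY_t = x(t)dt + dW_t under the constant input u ≡ 1, whose limit equals the value ℐ¹(ϑ) = 1/ϑ⁴ in Theorem 2.1.) -/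
open Set Filter MeasureTheory

/-- Lyapunov function of the damped oscillator `z'' + k z' + ϑ z = f`. -/
noncomputable def oscillatorEnergy (k ϑ z v : ℝ) : ℝ := v ^ 2 + k * z * v + (ϑ + k ^ 2 / 2) * z ^ 2

lemma sq_add_le_oscillatorEnergy {k ϑ : ℝ} (hϑ : 0 < ϑ) (z v : ℝ) :
    (v + k * z) ^ 2 ≤ 2 * oscillatorEnergy k ϑ z v := by
  unfold oscillatorEnergy
  nlinarith [sq_nonneg v, mul_nonneg hϑ.le (sq_nonneg z)]

lemma oscillatorEnergy_nonneg {k ϑ : ℝ} (hϑ : 0 < ϑ) (z v : ℝ) :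
    0 ≤ oscillatorEnergy k ϑ z v := by
  nlinarith [sq_add_le_oscillatorEnergy (k := k) hϑ z v, sq_nonneg (v + k * z)]

lemma hasDerivWithinAt_oscillatorEnergy {k ϑ t a f : ℝ} {z v : ℝ → ℝ} {s : Set ℝ}
    (hz : HasDerivWithinAt z (v t) s t) (hv : HasDerivWithinAt v a s t)
    (h : a + k * v t + ϑ * z t = f) :
    HasDerivWithinAt (fun r => oscillatorEnergy k ϑ (z r) (v r))
      (-k * v t ^ 2 - k * ϑ * z t ^ 2 + (2 * v t + k * z t) * f) s t := by
  unfold oscillatorEnergy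
  refine (((hv.pow 2).add ((hz.const_mul k).mul hv)).add
    ((hz.pow 2).const_mul (ϑ + k ^ 2 / 2))).congr_deriv ?_
  rw [← h]
  push_cast
  ring

lemma oscillatorEnergy_dissipation {k ϑ : ℝ} (hk : 0 < k) (hϑ : 0 < ϑ) (z v f : ℝ) :
    -k * v ^ 2 - k * ϑ * z ^ 2 + (2 * v + k * z) * f ≤
      -(k * ϑ / 2) * z ^ 2 + (2 / k + k / (2 * ϑ)) * f ^ 2 := by
  have key : -(k * ϑ / 2) * z ^ 2 + (2 / k + k / (2 * ϑ)) * f ^ 2 -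
      (-k * v ^ 2 - k * ϑ * z ^ 2 + (2 * v + k * z) * f) =
      k / 2 * v ^ 2 + k / 2 * (v - 2 / k * f) ^ 2 + k * ϑ / 2 * (z - f / ϑ) ^ 2 := by
    field_simp
    ring
  have : 0 ≤ k / 2 * v ^ 2 + k / 2 * (v - 2 / k * f) ^ 2 + k * ϑ / 2 * (z - f / ϑ) ^ 2 := by
    positivity
  linarith

lemma abs_le_of_sq_le_two_mul {a b : ℝ} (h : a ^ 2 ≤ 2 * b) : |a| ≤ b + 1 := by
  nlinarith [sq_abs a, sq_nonneg (|a| - 1)]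

lemma tendsto_average_of_abs_sub_le {F : ℝ → ℝ} {c K : ℝ}
    (h : ∀ T, 0 ≤ T → |F T - c * T| ≤ K) :
    Tendsto (fun T : ℝ => 1 / T * F T) atTop (nhds c) := by
  rw [tendsto_iff_norm_sub_tendsto_zero]
  refine squeeze_zero' (Eventually.of_forall fun _ => norm_nonneg _) ?_
    ((tendsto_const_nhds (x := K)).div_atTop tendsto_id)
  filter_upwards [eventually_gt_atTop 0] with T hT
  have : 1 / T * F T - c = (F T - c * T) / T := by field_simp
  rw [this, Real.norm_eq_abs, abs_div, abs_of_pos hT]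
  exact div_le_div_of_nonneg_right (h T hT.le) hT.le

/-- Lyapunov estimate for the cascade of two damped oscillators `w'' + k w' + ϑ w = 0` and
`v'' + k v' + ϑ v = -w`. -/
lemma exists_cascade_lyapunov {k ϑ : ℝ} (hk : 0 < k) (hϑ : 0 < ϑ)
    {w w' w'' v v' v'' : ℝ → ℝ}
    (hw1 : ∀ t ∈ Ici (0 : ℝ), HasDerivWithinAt w (w' t) (Ici 0) t)
    (hw2 : ∀ t ∈ Ici (0 : ℝ), HasDerivWithinAt w' (w'' t) (Ici 0) t)
    (hweq : ∀ t ∈ Ici (0 : ℝ), w'' t + k * w' t + ϑ * w t = 0)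
    (hv1 : ∀ t ∈ Ici (0 : ℝ), HasDerivWithinAt v (v' t) (Ici 0) t)
    (hv2 : ∀ t ∈ Ici (0 : ℝ), HasDerivWithinAt v' (v'' t) (Ici 0) t)
    (hveq : ∀ t ∈ Ici (0 : ℝ), v'' t + k * v' t + ϑ * v t = -w t) :
    ∃ (W W' : ℝ → ℝ) (C : ℝ),
      (∀ t ∈ Ici (0 : ℝ), HasDerivWithinAt W (W' t) (Ici 0) t) ∧
      (∀ t ∈ Ici (0 : ℝ), W' t ≤ -(k * ϑ / 2) * v t ^ 2) ∧
      (∀ t ∈ Ici (0 : ℝ), 0 ≤ W t ∧ W t ≤ C) ∧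
      (∀ t ∈ Ici (0 : ℝ), |w' t + k * w t| ≤ C ∧ |v' t + k * v t| ≤ C) := by
  set B := (2 / k + k / (2 * ϑ)) / (k * ϑ) with hB
  have hBpos : 0 < B := by positivity
  have hBeq : B * (k * ϑ) = 2 / k + k / (2 * ϑ) := by rw [hB]; field_simp
  set W : ℝ → ℝ := fun t =>
    oscillatorEnergy k ϑ (v t) (v' t) + B * oscillatorEnergy k ϑ (w t) (w' t)
  have hWd := fun t (ht : t ∈ Ici (0 : ℝ)) =>
    (hasDerivWithinAt_oscillatorEnergy (hv1 t ht) (hv2 t ht) (hveq t ht)).add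
      ((hasDerivWithinAt_oscillatorEnergy (hw1 t ht) (hw2 t ht) (hweq t ht)).const_mul B)
  have hWle : ∀ t ∈ Ici (0 : ℝ), -k * v' t ^ 2 - k * ϑ * v t ^ 2 + (2 * v' t + k * v t) * -w t +
      B * (-k * w' t ^ 2 - k * ϑ * w t ^ 2 + (2 * w' t + k * w t) * 0) ≤
      -(k * ϑ / 2) * v t ^ 2 := by
    intro t _
    have h1 := oscillatorEnergy_dissipation hk hϑ (v t) (v' t) (-w t)
    have h2 : 0 ≤ B * k * w' t ^ 2 := by positivity
    rw [← hBeq] at h1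
    linarith
  have hanti : AntitoneOn W (Ici 0) := by
    refine antitoneOn_of_hasDerivWithinAt_nonpos (convex_Ici 0)
      (fun t ht => (hWd t ht).continuousWithinAt)
      (fun t ht => (hWd t (interior_subset ht)).mono interior_subset) fun t ht => ?_
    have : 0 ≤ k * ϑ / 2 * v t ^ 2 := by positivity
    linarith [hWle t (interior_subset ht)]
  have hWle0 : ∀ t ∈ Ici (0 : ℝ), W t ≤ W 0 := fun t ht => hanti self_mem_Ici ht ht
  have hv0 := fun t => oscillatorEnergy_nonneg (k := k) hϑ (v t) (v' t)
  have hw0 := fun t => mul_nonneg hBpos.le (oscillatorEnergy_nonneg (k := k) hϑ (w t) (w' t))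
  have hW0 : 0 ≤ W 0 := add_nonneg (hv0 0) (hw0 0)
  have hdiv : 0 ≤ W 0 / B := by positivity
  refine ⟨W, _, W 0 + W 0 / B + 1, hWd, hWle, fun t ht => ⟨add_nonneg (hv0 t) (hw0 t), ?_⟩,
    fun t ht => ⟨?_, ?_⟩⟩
  · linarith [hWle0 t ht]
  · have h1 : oscillatorEnergy k ϑ (w t) (w' t) ≤ W 0 / B := by
      rw [le_div_iff₀ hBpos]
      have h2 : oscillatorEnergy k ϑ (v t) (v' t) + B * oscillatorEnergy k ϑ (w t) (w' t) ≤ W 0 :=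
        hWle0 t ht
      linarith [hv0 t]
    linarith [abs_le_of_sq_le_two_mul (sq_add_le_oscillatorEnergy (k := k) hϑ (w t) (w' t))]
  · have h2 : oscillatorEnergy k ϑ (v t) (v' t) + B * oscillatorEnergy k ϑ (w t) (w' t) ≤ W 0 :=
      hWle0 t ht
    linarith [hw0 t,
      abs_le_of_sq_le_two_mul (sq_add_le_oscillatorEnergy (k := k) hϑ (v t) (v' t))]

/-- Normalized Fisher information under the constant input `u ≡ 1` in the white-noise
observation model: if `x'' + k x' + ϑ x = 1`, `x(0) = x'(0) = 0`, and the sensitivity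
`y = ∂x/∂ϑ` solves `y'' + k y' + ϑ y = -x`, `y(0) = y'(0) = 0`, then
`(1/T) ∫₀ᵀ y(t)² dt → 1/ϑ⁴` as `T → ∞`. -/
theorem normalized_fisher_information_constant_input
    (k ϑ : ℝ) (hk : 0 < k) (hϑ : 0 < ϑ)
    (x x' x'' y y' y'' : ℝ → ℝ)
    (hx1 : ∀ t ∈ Set.Ici (0 : ℝ), HasDerivWithinAt x (x' t) (Set.Ici 0) t)
    (hx2 : ∀ t ∈ Set.Ici (0 : ℝ), HasDerivWithinAt x' (x'' t) (Set.Ici 0) t)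
    (hxc : ContinuousOn x'' (Set.Ici 0))
    (hxeq : ∀ t ∈ Set.Ici (0 : ℝ), x'' t + k * x' t + ϑ * x t = 1)
    (hx0 : x 0 = 0) (hx'0 : x' 0 = 0)
    (hy1 : ∀ t ∈ Set.Ici (0 : ℝ), HasDerivWithinAt y (y' t) (Set.Ici 0) t)
    (hy2 : ∀ t ∈ Set.Ici (0 : ℝ), HasDerivWithinAt y' (y'' t) (Set.Ici 0) t)
    (hyc : ContinuousOn y'' (Set.Ici 0))
    (hyeq : ∀ t ∈ Set.Ici (0 : ℝ), y'' t + k * y' t + ϑ * y t = -x t)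
    (hy0 : y 0 = 0) (hy'0 : y' 0 = 0) :
    Filter.Tendsto (fun T : ℝ => (1 / T) * ∫ t in (0 : ℝ)..T, (y t) ^ 2)
      Filter.atTop (nhds (1 / ϑ ^ 4)) := by
  obtain ⟨W, W', C, hWd, hWle, hWC, hC⟩ := exists_cascade_lyapunov hk hϑ
    (fun t ht => (hx1 t ht).sub_const (1 / ϑ)) hx2
    (fun t ht => by
      have := hxeq t ht
      field_simp
      linarith)
    (fun t ht => (hy1 t ht).add_const (1 / ϑ ^ 2)) hy2
    (fun t ht => by
      have h1 := hyeq t ht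
      have h2 : ϑ * (1 / ϑ ^ 2) = 1 / ϑ := by field_simp
      rw [mul_add, h2]
      linarith)
  set L : ℝ → ℝ := fun t => 2 / ϑ ^ 3 *
    ((x' t + k * (x t - 1 / ϑ)) / ϑ - (y' t + k * (y t + 1 / ϑ ^ 2))) with hL
  have hLd : ∀ t ∈ Ici (0 : ℝ),
      HasDerivWithinAt L (2 / ϑ ^ 2 * (y t + 1 / ϑ ^ 2)) (Ici 0) t := by
    intro t ht
    refine (((((hx2 t ht).add (((hx1 t ht).sub_const (1 / ϑ)).const_mul k)).div_const ϑ).sub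
      ((hy2 t ht).add (((hy1 t ht).add_const (1 / ϑ ^ 2)).const_mul k))).const_mul (2 / ϑ ^ 3)).congr_deriv ?_
    have h1 : x'' t + k * x' t = 1 - ϑ * x t := by linarith [hxeq t ht]
    have h2 : y'' t + k * y' t = -x t - ϑ * y t := by linarith [hyeq t ht]
    rw [h1, h2]
    field_simp
    ring
  have hLb : ∀ t ∈ Ici (0 : ℝ), |L t| ≤ 2 / ϑ ^ 3 * (C / ϑ + C) := by
    intro t ht
    rw [hL, abs_mul, abs_of_pos (by positivity : 0 < 2 / ϑ ^ 3)]
    refine mul_le_mul_of_nonneg_left ((abs_sub _ _).trans (add_le_add ?_ (hC t ht).2))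
      (by positivity)
    rw [abs_div, abs_of_pos hϑ]
    exact div_le_div_of_nonneg_right (hC t ht).1 hϑ.le
  have hlin : ∀ t ∈ Ici (0 : ℝ),
      HasDerivWithinAt (fun t => 1 / ϑ ^ 4 * t - L t)
        (1 / ϑ ^ 4 * 1 - 2 / ϑ ^ 2 * (y t + 1 / ϑ ^ 2)) (Ici 0) t :=
    fun t ht => ((hasDerivWithinAt_id t _).const_mul _).sub (hLd t ht)
  have hsq : ∀ t, y t ^ 2 =
      1 / ϑ ^ 4 * 1 - 2 / ϑ ^ 2 * (y t + 1 / ϑ ^ 2) + (y t + 1 / ϑ ^ 2) ^ 2 := by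
    intro t
    field_simp
    ring
  have hup := fun t (ht : t ∈ Ici (0 : ℝ)) =>
    (hlin t ht).sub ((hWd t ht).const_mul (2 / (k * ϑ)))
  refine tendsto_average_of_abs_sub_le
    (K := 2 * (2 / ϑ ^ 3 * (C / ϑ + C)) + 2 / (k * ϑ) * C) fun T hT => ?_
  have hsub : Icc 0 T ⊆ Ici (0 : ℝ) := Icc_subset_Ici_self
  have hint : IntegrableOn (fun t => y t ^ 2) (Icc 0 T) :=
    ContinuousOn.integrableOn_Icc fun t ht =>
      (((hy1 t (hsub ht)).continuousWithinAt).mono hsub).pow 2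
  have lower := intervalIntegral.sub_le_integral_of_hasDeriv_right_of_le hT
    (fun t ht => ((hlin t (hsub ht)).continuousWithinAt).mono hsub)
    (fun t ht => (hlin t ht.1.le).mono fun s hs => ht.1.le.trans (le_of_lt hs)) hint
    (fun t _ => by rw [hsq t]; linarith [sq_nonneg (y t + 1 / ϑ ^ 2)])
  have upper := intervalIntegral.integral_le_sub_of_hasDeriv_right_of_le hT
    (fun t ht => ((hup t (hsub ht)).continuousWithinAt).mono hsub)
    (fun t ht => (hup t ht.1.le).mono fun s hs => ht.1.le.trans (le_of_lt hs)) hint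
    (fun t ht => by
      have h1 := mul_le_mul_of_nonneg_left (hWle t ht.1.le)
        (by positivity : 0 ≤ 2 / (k * ϑ))
      have h2 : 2 / (k * ϑ) * (-(k * ϑ / 2) * (y t + 1 / ϑ ^ 2) ^ 2) =
        -(y t + 1 / ϑ ^ 2) ^ 2 := by field_simp
      rw [hsq t]
      linarith)
  have hLT := abs_le.1 (hLb T hT)
  have hL0 := abs_le.1 (hLb 0 self_mem_Ici)
  have hc : 0 ≤ 2 / (k * ϑ) := by positivity
  have hW0 := mul_le_mul_of_nonneg_left (hWC 0 self_mem_Ici).2 hc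
  have hWT := mul_nonneg hc (hWC T hT).1
  have hCnn := mul_nonneg hc ((hWC 0 self_mem_Ici).1.trans (hWC 0 self_mem_Ici).2)
  simp only [Pi.sub_apply] at upper
  rw [abs_le]
  constructor <;> linarith
end

section
/- Let k > 0 and ϑ > 0 with k² < 2ϑ, and set ω = √(ϑ − k²/2). Let x : [0,∞) → ℂ be twice continuously differentiable with x''(t) + k x'(t) + ϑ x(t) = e^{iωt} for all t ≥ 0 and x(0) = x'(0) = 0, and let y : [0,∞) → ℂ satisfy y''(t) + k y'(t) + ϑ y(t) = −x(t) with y(0) = y'(0) = 0. Then (1/T)·∫₀ᵀ |y(t)|² dt → 16/(k⁴ − 4k²ϑ)² as T → ∞. (This identifies the limiting normalized Fisher information ℐ²(ϑ) = 16/(k⁴ − 4k²ϑ)² of Theorem 2.3 under the oscillating input u(t) = e^{iωt}.) -/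
open Filter Set Topology in
/-- Solutions of the stable scalar equation `v' = μ v + f` with vanishing forcing decay to zero. -/
theorem tendsto_zero_of_hasDerivWithinAt_linear {μ : ℂ} (hμ : μ.re < 0) {v f : ℝ → ℂ}
    (hv : ∀ t ∈ Ici (0 : ℝ), HasDerivWithinAt v (μ * v t + f t) (Ici 0) t)
    (hf : Tendsto f atTop (𝓝 0)) : Tendsto v atTop (𝓝 0) := by
  rw [Metric.tendsto_nhds]
  intro ε hε
  set a := -μ.re with ha
  have ha0 : 0 < a := by linarith
  have hfε : ∀ᶠ t in atTop, ‖f t‖ < ε / 2 * a := by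
    have h := Metric.tendsto_nhds.1 hf (ε / 2 * a) (by positivity)
    simpa [dist_zero_right] using h
  obtain ⟨s₀, hs₀⟩ := eventually_atTop.1 hfε
  set s := max s₀ 0 with hs
  have hs0 : 0 ≤ s := le_max_right _ _
  have hexp : ∀ t : ℝ, HasDerivAt (fun t : ℝ => Complex.exp (-μ * t))
      (Complex.exp (-μ * t) * -μ) t := fun t => by
    have h1 : HasDerivAt (fun t : ℝ => -μ * (t : ℂ)) (-μ) t := by
      simpa using (Complex.ofRealCLM.hasDerivAt (x := t)).const_mul (-μ)
    exact h1.cexp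
  have hnorm : ∀ t : ℝ, ‖Complex.exp (-μ * t)‖ = Real.exp (a * t) := fun t => by
    rw [Complex.norm_exp]; simp [ha]
  have hg : ∀ t ∈ Ici (0 : ℝ), HasDerivWithinAt (fun t : ℝ => Complex.exp (-μ * t) * v t)
      (Complex.exp (-μ * t) * f t) (Ici 0) t := fun t ht => by
    refine ((hexp t).hasDerivWithinAt.mul (hv t ht)).congr_deriv ?_
    ring
  set C := ‖Complex.exp (-μ * s) * v s‖ with hC
  have hbound : ∀ t, s ≤ t →
      ‖Complex.exp (-μ * t) * v t‖ ≤ C + ε / 2 * Real.exp (a * t) := fun t ht => by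
    have hB : ∀ x, HasDerivAt (fun x : ℝ => C + ε / 2 * Real.exp (a * x))
        (ε / 2 * (Real.exp (a * x) * a)) x := fun x => by
      have h1 : HasDerivAt (fun x : ℝ => a * x) a x := by
        simpa using (hasDerivAt_id x).const_mul a
      exact (h1.exp.const_mul (ε / 2)).const_add C
    refine image_norm_le_of_norm_deriv_right_le_deriv_boundary
      (f := fun t : ℝ => Complex.exp (-μ * t) * v t)
      (f' := fun t : ℝ => Complex.exp (-μ * t) * f t) (a := s) (b := t)
      (fun x hx => ((hg x (hs0.trans hx.1)).continuousWithinAt).mono fun z hz => hs0.trans hz.1)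
      (fun x hx => (hg x (hs0.trans hx.1)).mono fun z hz => (hs0.trans hx.1).trans hz)
      ?_ hB ?_ ⟨ht, le_rfl⟩
    · have := Real.exp_pos (a * s)
      simp only [← hC]
      nlinarith
    · intro x hx
      have h1 := (hs₀ x ((le_max_left _ _).trans hx.1)).le
      rw [norm_mul, hnorm]
      have := mul_le_mul_of_nonneg_left h1 (Real.exp_pos (a * x)).le
      linarith
  have hdecay : Tendsto (fun t : ℝ => C * Real.exp (-(a * t))) atTop (𝓝 0) := by
    have h1 : Tendsto (fun t : ℝ => a * t) atTop atTop := tendsto_id.const_mul_atTop ha0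
    simpa using (Real.tendsto_exp_neg_atTop_nhds_zero.comp h1).const_mul C
  filter_upwards [eventually_ge_atTop s, hdecay.eventually_lt_const (half_pos hε)] with t ht hsmall
  have h1 := hbound t ht
  rw [norm_mul, hnorm] at h1
  have h2 : Real.exp (-(a * t)) * Real.exp (a * t) = 1 := by rw [← Real.exp_add]; simp
  have h3 := mul_le_mul_of_nonneg_left h1 (Real.exp_pos (-(a * t))).le
  rw [dist_zero_right]
  have h4 : Real.exp (-(a * t)) * (Real.exp (a * t) * ‖v t‖) = ‖v t‖ := by
    rw [← mul_assoc, h2, one_mul]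
  have h5 : Real.exp (-(a * t)) * (C + ε / 2 * Real.exp (a * t))
      = C * Real.exp (-(a * t)) + ε / 2 := by linear_combination (ε / 2) * h2
  linarith

open Filter Set Topology in
/-- Solutions of the underdamped oscillator with vanishing forcing decay to zero. -/
theorem tendsto_zero_of_damped_oscillator {k ϑ : ℝ} (hk : 0 < k) (hkϑ : k ^ 2 ≤ 4 * ϑ)
    {u u' f : ℝ → ℂ}
    (hu : ∀ t ∈ Ici (0 : ℝ), HasDerivWithinAt u (u' t) (Ici 0) t)
    (hu' : ∀ t ∈ Ici (0 : ℝ), HasDerivWithinAt u' (f t - k * u' t - ϑ * u t) (Ici 0) t)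
    (hf : Tendsto f atTop (𝓝 0)) : Tendsto u atTop (𝓝 0) := by
  set r := Real.sqrt (ϑ - k ^ 2 / 4) with hr
  have hr2 : (r : ℂ) ^ 2 = ϑ - k ^ 2 / 4 := by
    have : r ^ 2 = ϑ - k ^ 2 / 4 := Real.sq_sqrt (by linarith)
    exact_mod_cast this
  set μ : ℂ := -(k / 2 : ℝ) + r * Complex.I with hμ
  set ν : ℂ := -(k / 2 : ℝ) - r * Complex.I with hν
  have hμre : μ.re < 0 := by
    simpa [hμ, -Complex.ofReal_div] using hk
  have hνre : ν.re < 0 := by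
    simpa [hν, -Complex.ofReal_div] using hk
  have hsum : μ + ν = -k := by simp only [hμ, hν]; push_cast; ring
  have hprod : μ * ν = ϑ := by
    simp only [hμ, hν]; push_cast; linear_combination hr2 - r ^ 2 * Complex.I_sq
  have hv : Tendsto (fun t => u' t - μ * u t) atTop (𝓝 0) := by
    refine tendsto_zero_of_hasDerivWithinAt_linear hνre (f := f) (fun t ht => ?_) hf
    refine ((hu' t ht).sub ((hu t ht).const_mul μ)).congr_deriv ?_
    linear_combination u t * hprod - u' t * hsum
  refine tendsto_zero_of_hasDerivWithinAt_linear hμre (fun t ht => ?_) hv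
  exact (hu t ht).congr_deriv (by ring)

open Filter Set Topology MeasureTheory in
/-- The running average of a function continuous on `[0, ∞)` inherits its limit at infinity. -/
theorem tendsto_average_of_tendsto {h : ℝ → ℝ} {L : ℝ} (hc : ContinuousOn h (Ici 0))
    (hL : Tendsto h atTop (𝓝 L)) :
    Tendsto (fun T : ℝ => (1 / T) * ∫ t in (0 : ℝ)..T, h t) atTop (𝓝 L) := by
  have hint : ∀ a b, 0 ≤ a → 0 ≤ b → IntervalIntegrable h volume a b := fun a b ha hb =>
    (hc.mono fun z hz => (le_min ha hb).trans hz.1).intervalIntegrable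
  rw [Metric.tendsto_nhds]
  intro ε hε
  obtain ⟨s₀, hs₀⟩ := eventually_atTop.1 (Metric.tendsto_nhds.1 hL (ε / 2) (half_pos hε))
  set s := max s₀ 0 with hs
  have hs0 : 0 ≤ s := le_max_right _ _
  set C := |(∫ t in (0 : ℝ)..s, h t) - s * L| with hC
  filter_upwards [eventually_gt_atTop s, eventually_gt_atTop (2 * C / ε)] with T hT hTC
  have hT0 : 0 < T := hs0.trans_lt hT
  have htail : ‖∫ t in s..T, (h t - L)‖ ≤ ε / 2 * |T - s| := by
    refine intervalIntegral.norm_integral_le_of_norm_le_const fun t ht => ?_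
    rw [uIoc_of_le hT.le] at ht
    exact (hs₀ t ((le_max_left _ _).trans ht.1.le)).le
  rw [intervalIntegral.integral_sub (hint _ _ hs0 hT0.le) (by simp),
    intervalIntegral.integral_const, Real.norm_eq_abs, abs_of_pos (sub_pos.2 hT)] at htail
  have hsplit := intervalIntegral.integral_add_adjacent_intervals
    (hint 0 s le_rfl hs0) (hint s T hs0 hT0.le)
  have hCT : 2 * C < T * ε := (div_lt_iff₀ hε).1 hTC
  have hkey : |(∫ t in (0 : ℝ)..T, h t) - T * L| < ε * T := by
    have heq : (∫ t in (0 : ℝ)..T, h t) - T * L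
        = ((∫ t in (0 : ℝ)..s, h t) - s * L) + ((∫ t in s..T, h t) - (T - s) • L) := by
      rw [← hsplit, smul_eq_mul]; ring
    rw [heq]
    refine (abs_add_le _ _).trans_lt ?_
    nlinarith
  have hdiff : (1 / T) * (∫ t in (0 : ℝ)..T, h t) - L
      = ((∫ t in (0 : ℝ)..T, h t) - T * L) / T := by field_simp
  rw [Real.dist_eq, hdiff, abs_div, abs_of_pos hT0, div_lt_iff₀ hT0]
  exact hkey


/-- Normalized Fisher information under the oscillating input `u(t) = e^{iωt}`,
`ω = √(ϑ - k²/2)`, in the case `k² < 2ϑ`: if `x'' + k x' + ϑ x = e^{iωt}`,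
`x(0) = x'(0) = 0`, and the sensitivity `y = ∂x/∂ϑ` solves `y'' + k y' + ϑ y = -x`,
`y(0) = y'(0) = 0`, then `(1/T) ∫₀ᵀ |y(t)|² dt → 16/(k⁴ - 4k²ϑ)²` as `T → ∞`. -/
theorem normalized_fisher_information_oscillating_input
    (k ϑ : ℝ) (hk : 0 < k) (hϑ : 0 < ϑ) (hcase : k ^ 2 < 2 * ϑ)
    (ω : ℝ) (hω : ω = Real.sqrt (ϑ - k ^ 2 / 2))
    (x x' x'' y y' y'' : ℝ → ℂ)
    (hx1 : ∀ t ∈ Set.Ici (0 : ℝ), HasDerivWithinAt x (x' t) (Set.Ici 0) t)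
    (hx2 : ∀ t ∈ Set.Ici (0 : ℝ), HasDerivWithinAt x' (x'' t) (Set.Ici 0) t)
    (hxc : ContinuousOn x'' (Set.Ici 0))
    (hxeq : ∀ t ∈ Set.Ici (0 : ℝ),
      x'' t + (k : ℂ) * x' t + (ϑ : ℂ) * x t = Complex.exp (Complex.I * ω * t))
    (hx0 : x 0 = 0) (hx'0 : x' 0 = 0)
    (hy1 : ∀ t ∈ Set.Ici (0 : ℝ), HasDerivWithinAt y (y' t) (Set.Ici 0) t)
    (hy2 : ∀ t ∈ Set.Ici (0 : ℝ), HasDerivWithinAt y' (y'' t) (Set.Ici 0) t)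
    (hyc : ContinuousOn y'' (Set.Ici 0))
    (hyeq : ∀ t ∈ Set.Ici (0 : ℝ), y'' t + (k : ℂ) * y' t + (ϑ : ℂ) * y t = -x t)
    (hy0 : y 0 = 0) (hy'0 : y' 0 = 0) :
    Filter.Tendsto (fun T : ℝ => (1 / T) * ∫ t in (0 : ℝ)..T, ‖y t‖ ^ 2)
      Filter.atTop (nhds (16 / (k ^ 4 - 4 * k ^ 2 * ϑ) ^ 2)) := by
  set D : ℂ := ((ϑ - ω ^ 2 : ℝ) : ℂ) + (k * ω : ℝ) * Complex.I with hD
  have hω2 : ω ^ 2 = ϑ - k ^ 2 / 2 := by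
    rw [hω]; exact Real.sq_sqrt (by linarith)
  have hDn : ‖D‖ ^ 2 = (4 * k ^ 2 * ϑ - k ^ 4) / 4 := by
    rw [← Complex.normSq_eq_norm_sq, hD, Complex.normSq_add_mul_I, mul_pow, hω2]; ring
  have hpos : 0 < (4 * k ^ 2 * ϑ - k ^ 4) / 4 := by
    have : 0 < k ^ 2 := by positivity
    nlinarith
  have hD0 : D ≠ 0 := by
    intro h
    rw [h] at hDn
    simp at hDn
    linarith
  set e : ℝ → ℂ := fun t => Complex.exp (Complex.I * ω * t) with he
  have hD' : D = ϑ + Complex.I * ω * k + (Complex.I * ω) ^ 2 := by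
    rw [hD, mul_pow, Complex.I_sq]; push_cast; ring
  have hde : ∀ c : ℂ, ∀ t : ℝ, HasDerivWithinAt (fun t => c * e t) (c * (Complex.I * ω) * e t)
      (Set.Ici 0) t := fun c t => by
    have h1 : HasDerivAt (fun t : ℝ => Complex.I * ω * (t : ℂ)) (Complex.I * ω) t := by
      simpa using (Complex.ofRealCLM.hasDerivAt (x := t)).const_mul (Complex.I * ω)
    refine (h1.cexp.const_mul c).hasDerivWithinAt.congr_deriv ?_
    simp only [he]; ring
  have hz : Filter.Tendsto (fun t => x t - D⁻¹ * e t) Filter.atTop (nhds 0) := by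
    refine tendsto_zero_of_damped_oscillator (ϑ := ϑ) hk (by linarith) (f := fun _ => 0)
      (fun t ht => (hx1 t ht).sub (hde D⁻¹ t)) (fun t ht => ?_) tendsto_const_nhds
    refine ((hx2 t ht).sub (hde (D⁻¹ * (Complex.I * ω)) t)).congr_deriv ?_
    have h1 : x'' t + k * x' t + ϑ * x t = e t := hxeq t ht
    have h2 : D⁻¹ * D = 1 := inv_mul_cancel₀ hD0
    rw [hD'] at h2 ⊢
    linear_combination h1 - e t * h2
  have hw : Filter.Tendsto (fun t => y t - -(D⁻¹ ^ 2) * e t) Filter.atTop (nhds 0) := by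
    refine tendsto_zero_of_damped_oscillator (ϑ := ϑ) hk (by linarith)
      (f := fun t => -(x t - D⁻¹ * e t))
      (fun t ht => (hy1 t ht).sub (hde (-(D⁻¹ ^ 2)) t)) (fun t ht => ?_) (by simpa using hz.neg)
    refine ((hy2 t ht).sub (hde (-(D⁻¹ ^ 2) * (Complex.I * ω)) t)).congr_deriv ?_
    have h1 := hyeq t ht
    have h2 : D⁻¹ * D = 1 := inv_mul_cancel₀ hD0
    rw [hD'] at h2 ⊢
    linear_combination h1 + e t * (ϑ + Complex.I * ω * k + (Complex.I * ω) ^ 2)⁻¹ * h2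
  have hen : ∀ t, ‖e t‖ = 1 := fun t => by
    simp [he, Complex.norm_exp]
  have hyn : Filter.Tendsto (fun t => ‖y t‖) Filter.atTop (nhds (‖D‖⁻¹ ^ 2)) := by
    rw [tendsto_iff_dist_tendsto_zero]
    refine squeeze_zero (fun _ => dist_nonneg) (fun t => ?_) (by simpa using hw.norm)
    have h1 := abs_norm_sub_norm_le (y t) (-(D⁻¹ ^ 2) * e t)
    rw [norm_mul, hen, mul_one, norm_neg, norm_pow, norm_inv] at h1
    rw [Real.dist_eq]
    simpa using h1
  have hlim : 16 / (k ^ 4 - 4 * k ^ 2 * ϑ) ^ 2 = (‖D‖⁻¹ ^ 2) ^ 2 := by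
    rw [inv_pow, hDn, inv_div, div_pow]
    congr 1 <;> ring
  rw [hlim]
  refine tendsto_average_of_tendsto (ContinuousOn.pow (ContinuousOn.norm fun t ht => ?_) 2)
    (hyn.pow 2)
  exact (hy1 t ht).continuousWithinAt
end

section
/- Let k > 0, ϑ > 0 and ω ∈ ℝ. Let x : [0,∞) → ℂ be twice continuously differentiable with x''(t) + k x'(t) + ϑ x(t) = e^{iωt} for all t ≥ 0 and x(0) = x'(0) = 0, and let y : [0,∞) → ℂ satisfy y''(t) + k y'(t) + ϑ y(t) = −x(t) with y(0) = y'(0) = 0. Then, as t → ∞, x(t) − e^{iωt}/(ϑ − ω² + ikω) → 0 and y(t) + e^{iωt}/(ϑ − ω² + ikω)² → 0. In particular |y(t)|² → 1/((ϑ − ω²)² + k²ω²)². -/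
open Filter Topology in
/-- A perturbation vanishing at infinity of a stable scalar linear equation has decaying
solutions. -/
theorem tendsto_zero_of_deriv_eq_mul_add {c : ℂ} (hc : c.re < 0) {u f : ℝ → ℂ}
    (hu : ∀ t ∈ Set.Ici (0 : ℝ), HasDerivWithinAt u (c * u t + f t) (Set.Ici 0) t)
    (hf : Tendsto f atTop (𝓝 0)) : Tendsto u atTop (𝓝 0) := by
  obtain ⟨a, ha⟩ : ∃ a : ℝ, a = -c.re := ⟨_, rfl⟩
  have ha0 : 0 < a := by linarith
  have hnorm : ∀ t : ℝ, ‖Complex.exp (-c * t)‖ = Real.exp (a * t) := by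
    intro t
    simp [Complex.norm_exp, ha]
  rw [Metric.tendsto_atTop]
  intro ε hε
  have hδ : 0 < ε * a / 2 := by positivity
  obtain ⟨T₀, hT₀⟩ := Metric.tendsto_atTop.1 hf _ hδ
  obtain ⟨T, hTdef⟩ : ∃ T, T = max T₀ 0 := ⟨_, rfl⟩
  have hT0 : 0 ≤ T := hTdef ▸ le_max_right _ _
  have hfT : ∀ t, T ≤ t → ‖f t‖ ≤ ε * a / 2 := fun t ht => by
    have := hT₀ t ((hTdef ▸ le_max_left T₀ 0).trans ht)
    rw [dist_zero_right] at this
    exact this.le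
  have hg : ∀ t ∈ Set.Ici (0 : ℝ), HasDerivWithinAt (fun s : ℝ => Complex.exp (-c * s) * u s)
      (Complex.exp (-c * t) * f t) (Set.Ici 0) t := by
    intro t ht
    have h1 : HasDerivAt (fun s : ℝ => Complex.exp (-c * s)) (Complex.exp (-c * t) * (-c * 1)) t :=
      ((Complex.ofRealCLM.hasDerivAt (x := t)).const_mul (-c)).cexp
    refine (h1.hasDerivWithinAt.mul (hu t ht)).congr_deriv ?_
    ring
  obtain ⟨M, hM⟩ : ∃ M, M = ‖Complex.exp (-c * T) * u T‖ := ⟨_, rfl⟩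
  have hbound : ∀ t, T ≤ t → ‖u t‖ ≤ M * Real.exp (-(a * t)) + ε / 2 := by
    intro t ht
    have hB : ∀ s : ℝ, HasDerivAt
        (fun s : ℝ => M + ε / 2 * (Real.exp (a * s) - Real.exp (a * T)))
        (ε * a / 2 * Real.exp (a * s)) s := by
      intro s
      have h1 := ((((hasDerivAt_id s).const_mul a).exp.sub_const
        (Real.exp (a * T))).const_mul (ε / 2)).const_add M
      refine h1.congr_deriv ?_
      simp only [id]
      ring
    have key := image_norm_le_of_norm_deriv_right_le_deriv_boundary
      (f := fun s : ℝ => Complex.exp (-c * s) * u s)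
      (f' := fun s : ℝ => Complex.exp (-c * s) * f s) (a := T) (b := t)
      (fun s hs => ((hg s (hT0.trans hs.1)).continuousWithinAt).mono
        fun r hr => hT0.trans hr.1)
      (fun s hs => (hg s (hT0.trans hs.1)).mono fun r hr => (hT0.trans hs.1).trans hr)
      (by simp [hM]) hB
      (fun s hs => by
        rw [norm_mul, hnorm, mul_comm]
        exact mul_le_mul_of_nonneg_right (hfT s hs.1) (Real.exp_pos _).le)
      (Set.right_mem_Icc.2 ht)
    simp only [norm_mul, hnorm] at key
    have hE : Real.exp (-(a * t)) * Real.exp (a * t) = 1 := by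
      rw [← Real.exp_add]; simp
    have hp := Real.exp_pos (-(a * t))
    have hle := mul_le_mul_of_nonneg_left key hp.le
    have hpos : 0 ≤ Real.exp (-(a * t)) * (ε / 2 * Real.exp (a * T)) := by positivity
    calc ‖u t‖ = Real.exp (-(a * t)) * (Real.exp (a * t) * ‖u t‖) := by
          rw [← mul_assoc, hE, one_mul]
      _ ≤ _ := hle
      _ = M * Real.exp (-(a * t)) + ε / 2 * (Real.exp (-(a * t)) * Real.exp (a * t))
          - Real.exp (-(a * t)) * (ε / 2 * Real.exp (a * T)) := by ring
      _ ≤ _ := by rw [hE]; linarith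
  have hlim : Tendsto (fun t : ℝ => M * Real.exp (-(a * t))) atTop (𝓝 0) := by
    simpa using (Real.tendsto_exp_neg_atTop_nhds_zero.comp
      (tendsto_id.const_mul_atTop ha0)).const_mul M
  have hev := hlim.eventually (gt_mem_nhds (half_pos hε))
  obtain ⟨N, hN⟩ := eventually_atTop.1 hev
  refine ⟨max N T, fun t ht => ?_⟩
  have h1 := hN t ((le_max_left _ _).trans ht)
  have h2 := hbound t ((le_max_right _ _).trans ht)
  rw [dist_zero_right]
  linarith

theorem re_neg_of_quadratic_eq_zero {k ϑ : ℝ} (hk : 0 < k) (hϑ : 0 < ϑ) {c : ℂ}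
    (hc : c ^ 2 + k * c + ϑ = 0) : c.re < 0 := by
  have hre := congrArg Complex.re hc
  have him := congrArg Complex.im hc
  simp [pow_two] at hre him
  have h : c.im * (2 * c.re + k) = 0 := by linarith
  rcases mul_eq_zero.1 h with h | h
  · rw [h] at hre
    by_contra! hn
    nlinarith [mul_nonneg hk.le hn, mul_nonneg hn hn]
  · linarith

open Filter Topology in
/-- Solutions of a damped oscillator equation whose forcing vanishes at infinity decay. -/
theorem tendsto_zero_of_damped_oscillator_s5 {k ϑ : ℝ} (hk : 0 < k) (hϑ : 0 < ϑ)
    {z z' z'' f : ℝ → ℂ}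
    (hz : ∀ t ∈ Set.Ici (0 : ℝ), HasDerivWithinAt z (z' t) (Set.Ici 0) t)
    (hz' : ∀ t ∈ Set.Ici (0 : ℝ), HasDerivWithinAt z' (z'' t) (Set.Ici 0) t)
    (heq : ∀ t ∈ Set.Ici (0 : ℝ), z'' t + (k : ℂ) * z' t + (ϑ : ℂ) * z t = f t)
    (hf : Tendsto f atTop (𝓝 0)) : Tendsto z atTop (𝓝 0) := by
  obtain ⟨s, hs⟩ := IsAlgClosed.exists_pow_nat_eq ((k : ℂ) ^ 2 - 4 * ϑ) two_pos
  obtain ⟨c, hc⟩ : ∃ c : ℂ, c ^ 2 + k * c + ϑ = 0 :=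
    ⟨(-k + s) / 2, by linear_combination hs / 4⟩
  have hd : (-k - c) ^ 2 + k * (-k - c) + ϑ = 0 := by linear_combination hc
  have hu : Tendsto (fun t => z' t - c * z t) atTop (𝓝 0) := by
    refine tendsto_zero_of_deriv_eq_mul_add (re_neg_of_quadratic_eq_zero hk hϑ hd)
      (fun t ht => ((hz' t ht).sub ((hz t ht).const_mul c)).congr_deriv ?_) hf
    linear_combination heq t ht - z t * hc
  refine tendsto_zero_of_deriv_eq_mul_add (re_neg_of_quadratic_eq_zero hk hϑ hc)
    (fun t ht => (hz t ht).congr_deriv ?_) hu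
  ring


/-- Long-time asymptotics of the forced solution and its sensitivity: for
`x'' + k x' + ϑ x = e^{iωt}` with zero initial data and `y = ∂x/∂ϑ` solving
`y'' + k y' + ϑ y = -x` with zero initial data, one has
`x(t) - e^{iωt}/(ϑ - ω² + ikω) → 0` and `y(t) + e^{iωt}/(ϑ - ω² + ikω)² → 0`
as `t → ∞`; in particular `|y(t)|² → 1/((ϑ - ω²)² + k²ω²)²`. -/
theorem forced_solution_and_sensitivity_asymptotics
    (k ϑ ω : ℝ) (hk : 0 < k) (hϑ : 0 < ϑ)
    (x x' x'' y y' y'' : ℝ → ℂ)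
    (hx1 : ∀ t ∈ Set.Ici (0 : ℝ), HasDerivWithinAt x (x' t) (Set.Ici 0) t)
    (hx2 : ∀ t ∈ Set.Ici (0 : ℝ), HasDerivWithinAt x' (x'' t) (Set.Ici 0) t)
    (hxc : ContinuousOn x'' (Set.Ici 0))
    (hxeq : ∀ t ∈ Set.Ici (0 : ℝ),
      x'' t + (k : ℂ) * x' t + (ϑ : ℂ) * x t = Complex.exp (Complex.I * ω * t))
    (hx0 : x 0 = 0) (hx'0 : x' 0 = 0)
    (hy1 : ∀ t ∈ Set.Ici (0 : ℝ), HasDerivWithinAt y (y' t) (Set.Ici 0) t)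
    (hy2 : ∀ t ∈ Set.Ici (0 : ℝ), HasDerivWithinAt y' (y'' t) (Set.Ici 0) t)
    (hyc : ContinuousOn y'' (Set.Ici 0))
    (hyeq : ∀ t ∈ Set.Ici (0 : ℝ), y'' t + (k : ℂ) * y' t + (ϑ : ℂ) * y t = -x t)
    (hy0 : y 0 = 0) (hy'0 : y' 0 = 0) :
    Filter.Tendsto
      (fun t : ℝ => x t - Complex.exp (Complex.I * ω * t) / ((ϑ : ℂ) - (ω : ℂ) ^ 2 + Complex.I * k * ω))
      Filter.atTop (nhds 0) ∧
    Filter.Tendsto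
      (fun t : ℝ => y t + Complex.exp (Complex.I * ω * t) / ((ϑ : ℂ) - (ω : ℂ) ^ 2 + Complex.I * k * ω) ^ 2)
      Filter.atTop (nhds 0) ∧
    Filter.Tendsto (fun t : ℝ => ‖y t‖ ^ 2)
      Filter.atTop (nhds (1 / ((ϑ - ω ^ 2) ^ 2 + k ^ 2 * ω ^ 2) ^ 2)) := by
  obtain ⟨D, hD⟩ : ∃ D : ℂ, D = (ϑ : ℂ) - (ω : ℂ) ^ 2 + Complex.I * k * ω := ⟨_, rfl⟩
  have hsq : ‖D‖ ^ 2 = (ϑ - ω ^ 2) ^ 2 + k ^ 2 * ω ^ 2 := by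
    rw [← Complex.normSq_eq_norm_sq, Complex.normSq_apply, hD]
    simp [pow_two]
    ring
  have hD0 : D ≠ 0 := by
    rintro rfl
    rw [norm_zero] at hsq
    have h1 : k ^ 2 * ω ^ 2 = 0 := by nlinarith [sq_nonneg (ϑ - ω ^ 2), sq_nonneg (k * ω)]
    have h2 : ω ^ 2 = 0 := (mul_eq_zero.1 h1).resolve_left (by positivity)
    rw [h2] at hsq
    nlinarith [pow_pos hϑ 2]
  rw [← hD]
  have hexp : ∀ (b : ℂ) (t : ℝ), HasDerivAt
      (fun s : ℝ => b * Complex.exp (Complex.I * ω * s))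
      (b * (Complex.I * ω) * Complex.exp (Complex.I * ω * t)) t := by
    intro b t
    have h1 := (((Complex.ofRealCLM.hasDerivAt (x := t)).const_mul
      (Complex.I * (ω : ℂ))).cexp).const_mul b
    refine h1.congr_deriv ?_
    simp only [Complex.ofRealCLM_apply, Complex.ofReal_one]
    ring
  have hx : Filter.Tendsto (fun t : ℝ => x t - Complex.exp (Complex.I * ω * t) / D)
      Filter.atTop (nhds 0) := by
    have h := tendsto_zero_of_damped_oscillator_s5 hk hϑ (f := fun _ => 0)
      (fun t ht => (hx1 t ht).sub (hexp D⁻¹ t).hasDerivWithinAt)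
      (fun t ht => (hx2 t ht).sub (hexp (D⁻¹ * (Complex.I * ω)) t).hasDerivWithinAt)
      (fun t ht => by
        have hDD : D⁻¹ * D = 1 := inv_mul_cancel₀ hD0
        simp only [Pi.sub_apply]
        linear_combination hxeq t ht - Complex.exp (Complex.I * ω * t) * hDD
          + D⁻¹ * Complex.exp (Complex.I * ω * t) * hD
          - D⁻¹ * Complex.exp (Complex.I * ω * t) * (ω : ℂ) ^ 2 * Complex.I_sq)
      tendsto_const_nhds
    refine h.congr fun t => ?_
    simp only [Pi.sub_apply]
    ring
  have hy : Filter.Tendsto (fun t : ℝ => y t + Complex.exp (Complex.I * ω * t) / D ^ 2)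
      Filter.atTop (nhds 0) := by
    have h := tendsto_zero_of_damped_oscillator_s5 hk hϑ
      (f := fun t : ℝ => -(x t - Complex.exp (Complex.I * ω * t) / D))
      (fun t ht => (hy1 t ht).add (hexp (D⁻¹ ^ 2) t).hasDerivWithinAt)
      (fun t ht => (hy2 t ht).add (hexp (D⁻¹ ^ 2 * (Complex.I * ω)) t).hasDerivWithinAt)
      (fun t ht => by
        have hDD : D⁻¹ * D = 1 := inv_mul_cancel₀ hD0
        simp only [Pi.add_apply]
        linear_combination hyeq t ht + D⁻¹ * Complex.exp (Complex.I * ω * t) * hDD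
          - D⁻¹ ^ 2 * Complex.exp (Complex.I * ω * t) * hD
          + D⁻¹ ^ 2 * Complex.exp (Complex.I * ω * t) * (ω : ℂ) ^ 2 * Complex.I_sq)
      (by simpa using hx.neg)
    refine h.congr fun t => ?_
    simp only [Pi.add_apply]
    ring
  refine ⟨hx, hy, ?_⟩
  have hnorm : ∀ t : ℝ, ‖-(Complex.exp (Complex.I * ω * t) / D ^ 2)‖ = 1 / ‖D‖ ^ 2 := by
    intro t
    have h1 : ‖Complex.exp (Complex.I * ω * t)‖ = 1 := by simp [Complex.norm_exp]
    rw [norm_neg, norm_div, norm_pow, h1]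
  have hylim : Filter.Tendsto (fun t => ‖y t‖) Filter.atTop (nhds (1 / ‖D‖ ^ 2)) := by
    rw [tendsto_iff_dist_tendsto_zero]
    refine squeeze_zero (fun _ => dist_nonneg) (fun t => ?_) (by simpa using hy.norm)
    rw [← hnorm t, Real.dist_eq]
    simpa only [dist_zero_right, norm_norm, sub_neg_eq_add] using
      abs_norm_sub_norm_le (y t) (-(Complex.exp (Complex.I * ω * t) / D ^ 2))
  rw [← hsq]
  simpa [div_pow] using hylim.pow 2
end

section
/- Let k > 0, ϑ > 0 with k² ≥ 4ϑ, and let a < 0 satisfy a > −ϑ⁴/2 and a ≥ −(k⁴ − 4k²ϑ)²/32. Define y₁ = √((k² − 2ϑ + √(k⁴ − 4k²ϑ + 4√(−2a)))/2), y₃ = √((k² − 2ϑ − √(k⁴ − 4k²ϑ + 4√(−2a)))/2), y₅ = √((k² − 2ϑ + √(k⁴ − 4k²ϑ − 4√(−2a)))/2), y₇ = √((k² − 2ϑ − √(k⁴ − 4k²ϑ − 4√(−2a)))/2). Then all the expressions under the square roots are nonnegative, so y₁, y₃, y₅, y₇ are real and nonnegative, and each of the eight real numbers ±y₁, ±y₃,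 ±y₅, ±y₇ is a root of the polynomial P(y) = (y² − ky + ϑ)²(y² + ky + ϑ)² + 2a. -/
/-- If `2y² = k² - 2ϑ + r` with `r² = k⁴ - 4k²ϑ + 4s` and `s² = -2a`, then `y` is a root of
the eigenvalue polynomial. -/
theorem eigenvalue_polynomial_eq_zero {k ϑ a s r y : ℝ} (hs : s ^ 2 = -2 * a)
    (hr : r ^ 2 = k ^ 4 - 4 * k ^ 2 * ϑ + 4 * s) (hy : y ^ 2 = (k ^ 2 - 2 * ϑ + r) / 2) :
    (y ^ 2 - k * y + ϑ) ^ 2 * (y ^ 2 + k * y + ϑ) ^ 2 + 2 * a = 0 := by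
  have hquad : (y ^ 2 - k * y + ϑ) * (y ^ 2 + k * y + ϑ) = s := by
    calc (y ^ 2 - k * y + ϑ) * (y ^ 2 + k * y + ϑ)
        = (y ^ 2) ^ 2 + (2 * ϑ - k ^ 2) * y ^ 2 + ϑ ^ 2 := by ring
      _ = s := by rw [hy]; linear_combination hr / 4
  rw [← mul_pow, hquad, hs]
  ring

/-- In the case `k² ≥ 4ϑ` with `-ϑ⁴/2 < a < 0` and `a ≥ -(k⁴ - 4k²ϑ)²/32`, all expressions
under the square roots defining `y₁, y₃, y₅, y₇` are nonnegative, and each of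
`±y₁, ±y₃, ±y₅, ±y₇` is a real root of `P(y) = (y² - ky + ϑ)²(y² + ky + ϑ)² + 2a`. -/
theorem eight_real_roots_of_eigenvalue_polynomial
    (k ϑ a : ℝ) (hk : 0 < k) (hϑ : 0 < ϑ) (hcase : k ^ 2 ≥ 4 * ϑ)
    (ha0 : a < 0) (ha1 : a > -ϑ ^ 4 / 2) (ha2 : a ≥ -(k ^ 4 - 4 * k ^ 2 * ϑ) ^ 2 / 32) :
    0 ≤ k ^ 4 - 4 * k ^ 2 * ϑ + 4 * Real.sqrt (-2 * a) ∧
    0 ≤ k ^ 4 - 4 * k ^ 2 * ϑ - 4 * Real.sqrt (-2 * a) ∧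
    0 ≤ k ^ 2 - 2 * ϑ + Real.sqrt (k ^ 4 - 4 * k ^ 2 * ϑ + 4 * Real.sqrt (-2 * a)) ∧
    0 ≤ k ^ 2 - 2 * ϑ - Real.sqrt (k ^ 4 - 4 * k ^ 2 * ϑ + 4 * Real.sqrt (-2 * a)) ∧
    0 ≤ k ^ 2 - 2 * ϑ + Real.sqrt (k ^ 4 - 4 * k ^ 2 * ϑ - 4 * Real.sqrt (-2 * a)) ∧
    0 ≤ k ^ 2 - 2 * ϑ - Real.sqrt (k ^ 4 - 4 * k ^ 2 * ϑ - 4 * Real.sqrt (-2 * a)) ∧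
    ∀ y : ℝ,
      (y = Real.sqrt ((k ^ 2 - 2 * ϑ + Real.sqrt (k ^ 4 - 4 * k ^ 2 * ϑ + 4 * Real.sqrt (-2 * a))) / 2) ∨
       y = -Real.sqrt ((k ^ 2 - 2 * ϑ + Real.sqrt (k ^ 4 - 4 * k ^ 2 * ϑ + 4 * Real.sqrt (-2 * a))) / 2) ∨
       y = Real.sqrt ((k ^ 2 - 2 * ϑ - Real.sqrt (k ^ 4 - 4 * k ^ 2 * ϑ + 4 * Real.sqrt (-2 * a))) / 2) ∨
       y = -Real.sqrt ((k ^ 2 - 2 * ϑ - Real.sqrt (k ^ 4 - 4 * k ^ 2 * ϑ + 4 * Real.sqrt (-2 * a))) / 2) ∨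
       y = Real.sqrt ((k ^ 2 - 2 * ϑ + Real.sqrt (k ^ 4 - 4 * k ^ 2 * ϑ - 4 * Real.sqrt (-2 * a))) / 2) ∨
       y = -Real.sqrt ((k ^ 2 - 2 * ϑ + Real.sqrt (k ^ 4 - 4 * k ^ 2 * ϑ - 4 * Real.sqrt (-2 * a))) / 2) ∨
       y = Real.sqrt ((k ^ 2 - 2 * ϑ - Real.sqrt (k ^ 4 - 4 * k ^ 2 * ϑ - 4 * Real.sqrt (-2 * a))) / 2) ∨
       y = -Real.sqrt ((k ^ 2 - 2 * ϑ - Real.sqrt (k ^ 4 - 4 * k ^ 2 * ϑ - 4 * Real.sqrt (-2 * a))) / 2)) →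
      (y ^ 2 - k * y + ϑ) ^ 2 * (y ^ 2 + k * y + ϑ) ^ 2 + 2 * a = 0 := by
  have hs : Real.sqrt (-2 * a) ^ 2 = -2 * a := Real.sq_sqrt (by linarith)
  have hs0 : 0 ≤ Real.sqrt (-2 * a) := Real.sqrt_nonneg _
  set s := Real.sqrt (-2 * a)
  have hD : 0 ≤ k ^ 4 - 4 * k ^ 2 * ϑ := by
    have := mul_nonneg (sq_nonneg k) (sub_nonneg.mpr hcase)
    linarith
  have hsD : 4 * s ≤ k ^ 4 - 4 * k ^ 2 * ϑ :=
    (abs_le_of_sq_le_sq' (by linarith) hD).2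
  have hsϑ : s ≤ ϑ ^ 2 := (abs_le_of_sq_le_sq' (by linarith) (sq_nonneg ϑ)).2
  have hB : 0 ≤ k ^ 2 - 2 * ϑ := by linarith
  have hp : 0 ≤ k ^ 4 - 4 * k ^ 2 * ϑ + 4 * s := by linarith
  have hm : 0 ≤ k ^ 4 - 4 * k ^ 2 * ϑ - 4 * s := by linarith
  have hpB : Real.sqrt (k ^ 4 - 4 * k ^ 2 * ϑ + 4 * s) ≤ k ^ 2 - 2 * ϑ :=
    Real.sqrt_le_iff.mpr ⟨hB, by linarith⟩
  have hmB : Real.sqrt (k ^ 4 - 4 * k ^ 2 * ϑ - 4 * s) ≤ k ^ 2 - 2 * ϑ :=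
    Real.sqrt_le_iff.mpr ⟨hB, by linarith [sq_nonneg ϑ]⟩
  have hp2 := Real.sq_sqrt hp
  have hm2 := Real.sq_sqrt hm
  have hp0 := Real.sqrt_nonneg (k ^ 4 - 4 * k ^ 2 * ϑ + 4 * s)
  have hm0 := Real.sqrt_nonneg (k ^ 4 - 4 * k ^ 2 * ϑ - 4 * s)
  set p := Real.sqrt (k ^ 4 - 4 * k ^ 2 * ϑ + 4 * s)
  set m := Real.sqrt (k ^ 4 - 4 * k ^ 2 * ϑ - 4 * s)
  have sq_of_eq_or_neg {y w : ℝ} (hw : 0 ≤ w) (h : y = Real.sqrt w ∨ y = -Real.sqrt w) :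
      y ^ 2 = w := by
    rw [sq_eq_sq_iff_eq_or_eq_neg.mpr h, Real.sq_sqrt hw]
  refine ⟨hp, hm, by linarith, by linarith, by linarith, by linarith, fun y hy => ?_⟩
  have hy2 : y ^ 2 = (k ^ 2 - 2 * ϑ + p) / 2 ∨ y ^ 2 = (k ^ 2 - 2 * ϑ - p) / 2 ∨
      y ^ 2 = (k ^ 2 - 2 * ϑ + m) / 2 ∨ y ^ 2 = (k ^ 2 - 2 * ϑ - m) / 2 := by
    rcases hy with h | h | h | h | h | h | h | h
    · exact .inl (sq_of_eq_or_neg (by linarith) (.inl h))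
    · exact .inl (sq_of_eq_or_neg (by linarith) (.inr h))
    · exact .inr (.inl (sq_of_eq_or_neg (by linarith) (.inl h)))
    · exact .inr (.inl (sq_of_eq_or_neg (by linarith) (.inr h)))
    · exact .inr (.inr (.inl (sq_of_eq_or_neg (by linarith) (.inl h))))
    · exact .inr (.inr (.inl (sq_of_eq_or_neg (by linarith) (.inr h))))
    · exact .inr (.inr (.inr (sq_of_eq_or_neg (by linarith) (.inl h))))
    · exact .inr (.inr (.inr (sq_of_eq_or_neg (by linarith) (.inr h))))
  rcases hy2 with h | h | h | h
  · exact eigenvalue_polynomial_eq_zero (s := s) (r := p) hs hp2 h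
  · exact eigenvalue_polynomial_eq_zero (s := s) (r := -p) hs (by linarith) (by linarith)
  · exact eigenvalue_polynomial_eq_zero (s := -s) (r := m) (by linarith) (by linarith) h
  · exact eigenvalue_polynomial_eq_zero (s := -s) (r := -m) (by linarith) (by linarith) (by linarith)
end
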